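/- Let I=(V,E,c,D) be an instance of the min-congestion multi-commodity unsplittable flow problem whose minimum capacity is 1, let opt(I) denote the minimum congestion over all unsplittable flows serving D in (V,E,c), and let α be a real with α > max(opt(I), 1). Let I' be the MCRN instance constructed from I and α as described. Then the optimal congestion of I' under unsplittable segregated routing, i.e., the minimum over matchings M ⊆ ℰ' and unsplittable segregated flows serving D' in N(M) of the congestion, equals max(opt(I), 1). -/

import Mathlib

open Finset

namespace MCRN

/-- A directed link of a reconfigurable network: either a direction of a bidirected
static link (indexed by `E × Bool`) or a directed reconfigurable link `(i, j)`. -/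
abbrev SLink (V E : Type*) := (E × Bool) ⊕ (V × V)

variable {V E : Type*}

/-- Tail of a directed link. -/
def tl (src tgt : E → V) : SLink V E → V
  | .inl (e, b) => if b then src e else tgt e
  | .inr (i, _) => i

/-- Head of a directed link. -/
def hd (src tgt : E → V) : SLink V E → V
  | .inl (e, b) => if b then tgt e else src e
  | .inr (_, j) => j

variable [Fintype V] [DecidableEq V] [Fintype E] [DecidableEq E]

/-- Net outflow of `g` at node `v`. -/
def netOut (src tgt : E → V) (g : SLink V E → ℝ) (v : V) : ℝ :=
  (∑ a : SLink V E, if tl src tgt a = v then g a else 0)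
    - ∑ a : SLink V E, if hd src tgt a = v then g a else 0

/-- A matching: a set of non-diagonal unordered pairs, no two sharing an endpoint. -/
def IsMatching (M : Finset (Sym2 V)) : Prop :=
  (∀ p ∈ M, ¬ p.IsDiag) ∧ ∀ p ∈ M, ∀ q ∈ M, ∀ v : V, v ∈ p → v ∈ q → p = q

/-- A splittable flow serving demands `D` in the reconfigured network `N(M)`:
nonnegative, supported on static links and reconfigurable links of `M`,
conserved away from endpoints, and sending net flow `D i j` from `i` to `j`. -/
structure IsFlow (src tgt : E → V) (D : V → V → ℝ) (M : Finset (Sym2 V))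
    (f : V → V → SLink V E → ℝ) : Prop where
  nonneg : ∀ i j a, 0 ≤ f i j a
  supp : ∀ i j p q, s(p, q) ∉ M → f i j (Sum.inr (p, q)) = 0
  diag : ∀ i a, f i i a = 0
  conserve : ∀ i j v, v ≠ i → v ≠ j → netOut src tgt (f i j) v = 0
  demand : ∀ i j, i ≠ j → netOut src tgt (f i j) i = D i j

/-- A flow is segregated if each positive demand is carried either entirely by the
single directed reconfigurable link `(i, j)` or only by directed static links. -/
def Segregated (D : V → V → ℝ) (f : V → V → SLink V E → ℝ) : Prop :=
  ∀ i j, 0 < D i j →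
    (∀ a : SLink V E, a ≠ Sum.inr (i, j) → f i j a = 0) ∨
    ∀ p q : V, f i j (Sum.inr (p, q)) = 0

/-- Total flow on a directed link. -/
def totalFlow (f : V → V → SLink V E → ℝ) (a : SLink V E) : ℝ := ∑ i, ∑ j, f i j a

/-- The congestion (maximum load) of the flow `f` in `N(M)` is at most `lam`. -/
def CongLE (c : SLink V E → ℝ) (M : Finset (Sym2 V)) (f : V → V → SLink V E → ℝ)
    (lam : ℝ) : Prop :=
  (∀ (e : E) (b : Bool), totalFlow f (Sum.inl (e, b)) ≤ lam * c (Sum.inl (e, b))) ∧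
  ∀ p q : V, s(p, q) ∈ M → totalFlow f (Sum.inr (p, q)) ≤ lam * c (Sum.inr (p, q))

/-- The congestion (maximum load) of the flow `f` in `N(M)` is at least `lam`:
some existing directed link has load at least `lam`. -/
def CongGE (c : SLink V E → ℝ) (M : Finset (Sym2 V)) (f : V → V → SLink V E → ℝ)
    (lam : ℝ) : Prop :=
  (∃ (e : E) (b : Bool), lam * c (Sum.inl (e, b)) ≤ totalFlow f (Sum.inl (e, b))) ∨
  ∃ p q : V, s(p, q) ∈ M ∧ lam * c (Sum.inr (p, q)) ≤ totalFlow f (Sum.inr (p, q))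

/-- A (nonempty, repetition-free) directed path from `i` to `j`. -/
def IsDiPath (src tgt : E → V) (i j : V) (P : List (SLink V E)) : Prop :=
  P ≠ [] ∧ P.Nodup ∧ P.Chain' (fun a b => hd src tgt a = tl src tgt b) ∧
    P.head?.map (tl src tgt) = some i ∧ P.getLast?.map (hd src tgt) = some j

/-- The flow is unsplittable: each positive demand is routed along a single directed path. -/
def Unsplittable (src tgt : E → V) (D : V → V → ℝ) (f : V → V → SLink V E → ℝ) : Prop :=
  ∀ i j, 0 < D i j → ∃ P : List (SLink V E), IsDiPath src tgt i j P ∧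
    (∀ a ∈ P, f i j a = D i j) ∧ ∀ a : SLink V E, a ∉ P → f i j a = 0

end MCRN

namespace MCRN
namespace Red

/-- Static links of the constructed instance: the original links `E` together with one
new link `{v_i, v_i'}` for each original node. -/
def src2 {V E : Type*} (src : E → V) : E ⊕ V → V ⊕ V
  | .inl e => .inl (src e)
  | .inr v => .inl v

def tgt2 {V E : Type*} (tgt : E → V) : E ⊕ V → V ⊕ V
  | .inl e => .inl (tgt e)
  | .inr v => .inr v

/-- Capacities of the constructed instance: original static links keep their
capacities, the new static links `{v_i, v_i'}` have capacity `1` both ways, the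
reconfigurable direction `(v_i, v_i')` has capacity `α`, and every other
reconfigurable directed link has capacity `1`. -/
noncomputable def cap2 {V E : Type*} [DecidableEq V] (c : E → Bool → ℝ) (α : ℝ) :
    SLink (V ⊕ V) (E ⊕ V) → ℝ
  | .inl (.inl e, b) => c e b
  | .inl (.inr _, _) => 1
  | .inr (.inl v, .inr w) => if v = w then α else 1
  | .inr _ => 1

/-- Demands of the constructed instance: the original demands `D` together with a
demand `α` from `v_i` to `v_i'` for every original node. -/
noncomputable def D2 {V : Type*} [DecidableEq V] (D : V → V → ℝ) (α : ℝ) :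
    V ⊕ V → V ⊕ V → ℝ
  | .inl i, .inl j => D i j
  | .inl i, .inr j => if i = j then α else 0
  | _, _ => 0

/-- Capacities of the base instance, seen as a reconfigurable network with the empty
reconfiguration (reconfigurable capacities are irrelevant). -/
noncomputable def capBase {V E : Type*} (c : E → Bool → ℝ) : SLink V E → ℝ
  | .inl (e, b) => c e b
  | .inr _ => 1

end Red
end MCRN

namespace MCRN
open Red

/-- The list of links `P` is a directed walk from `x` to `y`. -/
def IsDiWalk {V E : Type*} (src tgt : E → V) : V → V → List (SLink V E) → Prop
  | x, y, [] => x = y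
  | x, y, a :: P => tl src tgt a = x ∧ IsDiWalk src tgt (hd src tgt a) y P

lemma isDiWalk_cons_iff {V E : Type*} (src tgt : E → V) (x y : V) (a : SLink V E)
    (P : List (SLink V E)) :
    IsDiWalk src tgt x y (a :: P) ↔
      (a :: P).IsChain (fun a b => hd src tgt a = tl src tgt b) ∧
        tl src tgt a = x ∧ ((a :: P).getLast?).map (hd src tgt) = some y := by
  induction P generalizing x a with
  | nil => simp [IsDiWalk]
  | cons b P ih =>
    rw [IsDiWalk, ih, List.isChain_cons_cons, List.getLast?_cons_cons]
    tauto

lemma isDiPath_iff {V E : Type*} (src tgt : E → V) (i j : V) (P : List (SLink V E)) :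
    IsDiPath src tgt i j P ↔ P ≠ [] ∧ P.Nodup ∧ IsDiWalk src tgt i j P := by
  cases P with
  | nil => simp [IsDiPath]
  | cons a P =>
    simp only [isDiWalk_cons_iff, IsDiPath, List.head?_cons, Option.map_some, Option.some_inj]
    rfl

lemma IsDiWalk.exists_hd_eq {V E : Type*} {src tgt : E → V} {x y : V} {P : List (SLink V E)}
    (h : IsDiWalk src tgt x y P) (hP : P ≠ []) : ∃ a ∈ P, hd src tgt a = y := by
  induction P generalizing x with
  | nil => exact absurd rfl hP
  | cons a P ih =>
    by_cases hn : P = []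
    · subst hn
      exact ⟨a, by simp, h.2⟩
    · obtain ⟨b, hb, hy⟩ := ih h.2 hn
      exact ⟨b, List.mem_cons_of_mem _ hb, hy⟩

namespace Red

/-- The link of the constructed network corresponding to a link of the base network. -/
def liftLink {V E : Type*} : SLink V E → SLink (V ⊕ V) (E ⊕ V)
  | .inl (e, b) => .inl (.inl e, b)
  | .inr (i, j) => .inr (.inl i, .inl j)

/-- The original static link underlying a link of the constructed network, if any. -/
def baseLink {V E : Type*} : SLink (V ⊕ V) (E ⊕ V) → Option (SLink V E)
  | .inl (.inl e, b) => some (.inl (e, b))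
  | _ => none

/-- The original node underlying a node of the constructed network. -/
def baseNode {V : Type*} : V ⊕ V → V := Sum.elim id id

lemma liftLink_injective {V E : Type*} :
    Function.Injective (liftLink : SLink V E → SLink (V ⊕ V) (E ⊕ V)) := by
  rintro (⟨e, b⟩ | ⟨i, j⟩) (⟨e', b'⟩ | ⟨i', j'⟩) h <;> simp_all [liftLink]

lemma baseLink_eq_some {V E : Type*} {a : SLink (V ⊕ V) (E ⊕ V)} {a' : SLink V E}
    (h : baseLink a = some a') : ∃ e b, a = .inl (.inl e, b) ∧ a' = .inl (e, b) := by
  rcases a with ⟨e | v, b⟩ | p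
  · exact ⟨e, b, rfl, (Option.some.inj h).symm⟩
  · simp [baseLink] at h
  · simp [baseLink] at h

lemma isDiWalk_map_liftLink {V E : Type*} {src tgt : E → V} {x y : V} {P : List (SLink V E)}
    (h : IsDiWalk src tgt x y P) :
    IsDiWalk (src2 src) (tgt2 tgt) (.inl x) (.inl y) (P.map liftLink) := by
  induction P generalizing x with
  | nil => exact congrArg Sum.inl h
  | cons a P ih =>
    obtain ⟨rfl, h⟩ := h
    have := ih h
    rcases a with ⟨e, _ | _⟩ | ⟨i, j⟩ <;>
      simpa [IsDiWalk, tl, hd, liftLink, src2, tgt2] using this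

lemma isDiPath_map_liftLink {V E : Type*} {src tgt : E → V} {i j : V} {P : List (SLink V E)}
    (h : IsDiPath src tgt i j P) :
    IsDiPath (src2 src) (tgt2 tgt) (.inl i) (.inl j) (P.map liftLink) := by
  rw [isDiPath_iff] at h ⊢
  exact ⟨by simpa using h.1, h.2.1.map liftLink_injective, isDiWalk_map_liftLink h.2.2⟩

lemma isDiWalk_filterMap_baseLink {V E : Type*} {src tgt : E → V} {x y : V ⊕ V}
    {P : List (SLink (V ⊕ V) (E ⊕ V))} (h : IsDiWalk (src2 src) (tgt2 tgt) x y P)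
    (hP : ∀ p, Sum.inr p ∉ P) :
    IsDiWalk src tgt (baseNode x) (baseNode y) (P.filterMap baseLink) := by
  induction P generalizing x with
  | nil => exact congrArg baseNode h
  | cons a P ih =>
    obtain ⟨rfl, h⟩ := h
    have := ih h fun p hp => hP p (List.mem_cons_of_mem _ hp)
    rcases a with ⟨e | v, _ | _⟩ | p
    · simpa [IsDiWalk, tl, hd, baseLink, src2, tgt2, baseNode] using this
    · simpa [IsDiWalk, tl, hd, baseLink, src2, tgt2, baseNode] using this
    · simpa [IsDiWalk, tl, hd, List.filterMap_cons, baseLink, src2, tgt2, baseNode] using this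
    · simpa [IsDiWalk, tl, hd, List.filterMap_cons, baseLink, src2, tgt2, baseNode] using this
    · exact absurd List.mem_cons_self (hP p)

lemma isDiPath_filterMap_baseLink {V E : Type*} {src tgt : E → V} {i j : V} (hij : i ≠ j)
    {P : List (SLink (V ⊕ V) (E ⊕ V))}
    (h : IsDiPath (src2 src) (tgt2 tgt) (.inl i) (.inl j) P) (hP : ∀ p, Sum.inr p ∉ P) :
    IsDiPath src tgt i j (P.filterMap baseLink) := by
  rw [isDiPath_iff] at h ⊢
  have hw := isDiWalk_filterMap_baseLink h.2.2 hP
  refine ⟨fun hn => hij ?_, h.2.1.filterMap ?_, hw⟩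
  · rw [hn] at hw
    exact hw
  · intro a a' b hb hb'
    obtain ⟨e, s, rfl, rfl⟩ := baseLink_eq_some hb
    obtain ⟨e', s', rfl, h'⟩ := baseLink_eq_some hb'
    simp_all

/-- The restriction to the base network of a flow on the links of the constructed network. -/
def restrict {V E : Type*} (h : SLink (V ⊕ V) (E ⊕ V) → ℝ) : SLink V E → ℝ
  | .inl (e, b) => h (.inl (.inl e, b))
  | .inr _ => 0

/-- The extension by zero of a flow on the static links of the base network. -/
def extend {V E : Type*} (g : SLink V E → ℝ) : SLink (V ⊕ V) (E ⊕ V) → ℝ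
  | .inl (.inl e, b) => g (.inl (e, b))
  | _ => 0

lemma netOut_restrict {V E : Type*} [Fintype V] [DecidableEq V] [Fintype E]
    (src tgt : E → V) (h : SLink (V ⊕ V) (E ⊕ V) → ℝ)
    (h0 : ∀ p, h (.inr p) = 0) (v : V) :
    netOut src tgt (restrict h) v =
      netOut (src2 src) (tgt2 tgt) h (.inl v) + netOut (src2 src) (tgt2 tgt) h (.inr v) := by
  have hr : ∀ p, restrict h (.inr p) = 0 := fun _ => rfl
  simp only [netOut, Fintype.sum_sum_type, h0, hr, ite_self, Finset.sum_const_zero, add_zero]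
  simp only [Fintype.sum_prod_type, Fintype.sum_sum_type, Fintype.sum_bool, tl, hd,
    src2, tgt2, restrict]
  simp [Finset.sum_add_distrib]
  ring

lemma netOut_extend_inl {V E : Type*} [Fintype V] [DecidableEq V] [Fintype E]
    (src tgt : E → V) (g : SLink V E → ℝ) (h0 : ∀ p, g (.inr p) = 0)
    (v : V) :
    netOut (src2 src) (tgt2 tgt) (extend g) (.inl v) = netOut src tgt g v := by
  simp [netOut, Fintype.sum_sum_type, Fintype.sum_prod_type, tl, hd, src2, tgt2, extend, h0]

lemma netOut_extend_inr {V E : Type*} [Fintype V] [DecidableEq V] [Fintype E]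
    (src tgt : E → V) (g : SLink V E → ℝ) (v : V) :
    netOut (src2 src) (tgt2 tgt) (extend g) (.inr v) = 0 := by
  simp [netOut, Fintype.sum_sum_type, Fintype.sum_prod_type, tl, hd, src2, tgt2, extend]

end Red

lemma netOut_zero {V E : Type*} [Fintype V] [DecidableEq V] [Fintype E]
    (src tgt : E → V) (v : V) :
    netOut src tgt (fun _ => 0) v = 0 := by
  simp [netOut]

lemma netOut_single {V E : Type*} [Fintype V] [DecidableEq V] [Fintype E] [DecidableEq E]
    (src tgt : E → V) (l : SLink V E) (x : ℝ) (v : V) :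
    netOut src tgt (fun a => if a = l then x else 0) v =
      (if tl src tgt l = v then x else 0) - if hd src tgt l = v then x else 0 := by
  unfold netOut
  congr 1 <;>
  · rw [Finset.sum_eq_single l] <;> simp +contextual

lemma le_totalFlow {V E : Type*} [Fintype V]
    {f : V → V → SLink V E → ℝ} (hf : ∀ i j a, 0 ≤ f i j a) (i j : V)
    (a : SLink V E) : f i j a ≤ totalFlow f a :=
  (Finset.single_le_sum (f := fun j => f i j a) (fun j _ => hf i j a) (mem_univ j)).trans
    (Finset.single_le_sum (f := fun i => ∑ j, f i j a)
      (fun i _ => Finset.sum_nonneg fun j _ => hf i j a) (mem_univ i))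

lemma IsMatching.inl_inl_notMem {V : Type*}
    {M : Finset (Sym2 (V ⊕ V))} (hM : IsMatching M)
    (h : ∀ v : V, s(.inl v, .inr v) ∈ M) (i j : V) : s(.inl i, .inl j) ∉ M := by
  intro hij
  have := hM.2 _ hij _ (h i) (.inl i) (by simp) (by simp)
  simp at this

namespace Red

/-- The matching pairing every original node with its copy. -/
def pairMatching (V : Type*) [Fintype V] [DecidableEq V] : Finset (Sym2 (V ⊕ V)) :=
  univ.image fun v : V => s(.inl v, .inr v)

lemma isMatching_pairMatching {V : Type*} [Fintype V] [DecidableEq V] :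
    IsMatching (pairMatching V) := by
  constructor
  · intro p hp
    obtain ⟨v, -, rfl⟩ := mem_image.1 hp
    simp
  · intro p hp q hq x hx hy
    obtain ⟨v, -, rfl⟩ := mem_image.1 hp
    obtain ⟨w, -, rfl⟩ := mem_image.1 hq
    rcases x with x | x <;> simp_all

/-- The flow on the constructed network obtained from a flow `g` on the base network by
routing the demand from each node to its copy along their reconfigurable link. -/
def extendFlow {V E : Type*} [DecidableEq V] [DecidableEq E] (α : ℝ) (g : V → V → SLink V E → ℝ) :
    V ⊕ V → V ⊕ V → SLink (V ⊕ V) (E ⊕ V) → ℝ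
  | .inl i, .inl j => extend (g i j)
  | .inl i, .inr j => fun a =>
      if a = .inr (.inl i, .inr i) then (if i = j then α else 0) else 0
  | .inr _, _ => fun _ => 0

lemma isFlow_extendFlow {V E : Type*} [Fintype V] [DecidableEq V] [Fintype E] [DecidableEq E]
    {src tgt : E → V} {D : V → V → ℝ} {g : V → V → SLink V E → ℝ}
    (hg : IsFlow src tgt D ∅ g) {α : ℝ} (hα : 0 ≤ α) :
    IsFlow (src2 src) (tgt2 tgt) (D2 D α) (pairMatching V) (extendFlow α g) where
  nonneg := by
    rintro (i | i) (j | j) a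
    · rcases a with ⟨e | v, b⟩ | p
      · exact hg.nonneg _ _ _
      · exact le_rfl
      · exact le_rfl
    · simp only [extendFlow]
      split_ifs <;> simp [hα]
    all_goals exact le_rfl
  supp := by
    rintro (i | i) (j | j) p q hpq
    · rfl
    · simp only [extendFlow]
      rw [if_neg]
      rintro h
      simp only [Sum.inr.injEq, Prod.mk.injEq] at h
      obtain ⟨rfl, rfl⟩ := h
      exact hpq (mem_image_of_mem _ (mem_univ i))
    all_goals rfl
  diag := by
    rintro (i | i) a
    · rcases a with ⟨e | v, b⟩ | p
      · exact hg.diag _ _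
      · rfl
      · rfl
    · rfl
  conserve := by
    rintro (i | i) (j | j) (v | v) hi hj
    · simp only [extendFlow]
      rw [netOut_extend_inl _ _ _ fun p => hg.supp i j p.1 p.2 (by simp)]
      exact hg.conserve _ _ _ (by simpa using hi) (by simpa using hj)
    · exact netOut_extend_inr _ _ _ _
    · simp only [extendFlow, netOut_single, tl, hd]
      simp_all [eq_comm]
    · simp only [extendFlow, netOut_single, tl, hd]
      simp_all [eq_comm]
    all_goals exact netOut_zero _ _ _
  demand := by
    rintro (i | i) (j | j) hij
    · simp only [extendFlow]
      rw [netOut_extend_inl _ _ _ fun p => hg.supp i j p.1 p.2 (by simp)]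
      exact hg.demand _ _ (by simpa using hij)
    · simp [extendFlow, netOut_single, tl, hd, D2]
    all_goals exact netOut_zero _ _ _

lemma unsplittable_extendFlow {V E : Type*} [Fintype V] [DecidableEq V] [Fintype E] [DecidableEq E]
    {src tgt : E → V} {D : V → V → ℝ} {g : V → V → SLink V E → ℝ}
    (hg : IsFlow src tgt D ∅ g) (hu : Unsplittable src tgt D g) (α : ℝ) :
    Unsplittable (src2 src) (tgt2 tgt) (D2 D α) (extendFlow α g) := by
  rintro (i | i) (j | j) hij
  · obtain ⟨P, hP, hPD, hP0⟩ := hu i j hij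
    refine ⟨P.map liftLink, isDiPath_map_liftLink hP, ?_, ?_⟩
    · intro a ha
      obtain ⟨⟨e, b⟩ | ⟨p, q⟩, hb, rfl⟩ := List.mem_map.1 ha
      · exact hPD _ hb
      · have h1 := hPD _ hb
        rw [hg.supp i j p q (by simp)] at h1
        exact absurd h1 (ne_of_lt hij)
    · rintro (⟨e | v, b⟩ | p) ha
      · exact hP0 _ fun h => ha (List.mem_map.2 ⟨_, h, rfl⟩)
      · rfl
      · rfl
  · have h : i = j := by
      by_contra h
      simp [D2, h] at hij
    subst h
    refine ⟨[.inr (.inl i, .inr i)], ?_, ?_, ?_⟩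
    · simp [isDiPath_iff, IsDiWalk, tl, hd]
    · simp [extendFlow, D2]
    · intro a ha
      simp only [extendFlow]
      rw [if_neg (by simpa using ha)]
  all_goals exact absurd hij (lt_irrefl _)

lemma segregated_extendFlow {V E : Type*} [DecidableEq V] [DecidableEq E]
    (D : V → V → ℝ) (g : V → V → SLink V E → ℝ) (α : ℝ) :
    Segregated (D2 D α) (extendFlow α g) := by
  rintro (i | i) (j | j) hij
  · exact .inr fun p q => rfl
  · left
    have h : i = j := by
      by_contra h
      simp [D2, h] at hij
    subst h
    intro a ha
    exact if_neg ha
  all_goals exact absurd hij (lt_irrefl _)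

lemma totalFlow_extendFlow_inl_inl {V E : Type*} [Fintype V] [DecidableEq V] [DecidableEq E]
    (α : ℝ) (g : V → V → SLink V E → ℝ) (e : E) (b : Bool) :
    totalFlow (extendFlow α g) (.inl (.inl e, b)) = totalFlow g (.inl (e, b)) := by
  simp [totalFlow, extendFlow, extend, Fintype.sum_sum_type]

lemma congLE_extendFlow {V E : Type*} [Fintype V] [DecidableEq V] [DecidableEq E]
    {c : E → Bool → ℝ} (hc : ∀ e b, 0 ≤ c e b) {g : V → V → SLink V E → ℝ}
    {lam lam' α : ℝ} (hg : CongLE (capBase c) ∅ g lam) (hlam : lam ≤ lam') (h1 : 1 ≤ lam')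
    (hα : 0 ≤ α) :
    CongLE (cap2 c α) (pairMatching V) (extendFlow α g) lam' := by
  constructor
  · rintro (e | v) b
    · rw [totalFlow_extendFlow_inl_inl]
      exact (hg.1 e b).trans (mul_le_mul_of_nonneg_right hlam (hc e b))
    · simp only [totalFlow, extendFlow, extend, cap2, Fintype.sum_sum_type]
      simp
      linarith
  · intro p q hpq
    obtain ⟨v, -, hv⟩ := mem_image.1 hpq
    rcases Sym2.eq_iff.1 hv with ⟨rfl, rfl⟩ | ⟨rfl, rfl⟩
    · have : totalFlow (extendFlow α g) (.inr (.inl v, .inr v)) = α := by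
        simp [totalFlow, extendFlow, extend, Fintype.sum_sum_type]
      rw [this]
      simp only [cap2, if_true]
      nlinarith
    · simp only [totalFlow, extendFlow, extend, cap2, Fintype.sum_sum_type]
      simp
      linarith

lemma hd_inl_eq_inr {V E : Type*}
    {src tgt : E → V} {l : (E ⊕ V) × Bool} {v : V}
    (h : hd (src2 src) (tgt2 tgt) (.inl l) = .inr v) : l = (.inr v, true) := by
  rcases l with ⟨e | w, _ | _⟩ <;> simp_all [hd, src2, tgt2]

/-- In a segregated unsplittable flow whose congestion is below `α`, the demand from a node
to its copy uses their reconfigurable link. -/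
lemma flow_pair_eq {V E : Type*} [Fintype V] [DecidableEq V] [Fintype E] [DecidableEq E]
    {src tgt : E → V} {c : E → Bool → ℝ} {D : V → V → ℝ} {α lam : ℝ}
    {M : Finset (Sym2 (V ⊕ V))} {f : V ⊕ V → V ⊕ V → SLink (V ⊕ V) (E ⊕ V) → ℝ}
    (hf : IsFlow (src2 src) (tgt2 tgt) (D2 D α) M f)
    (hu : Unsplittable (src2 src) (tgt2 tgt) (D2 D α) f)
    (hs : Segregated (D2 D α) f) (hcong : CongLE (cap2 c α) M f lam)
    (hα : 0 < α) (hlam : lam < α) (v : V) :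
    f (.inl v) (.inr v) (.inr (.inl v, .inr v)) = α := by
  have hD : D2 D α (.inl v) (.inr v) = α := by simp [D2]
  obtain ⟨P, hP, hPD, -⟩ := hu (.inl v) (.inr v) (by rwa [hD])
  rw [isDiPath_iff] at hP
  obtain ⟨a, ha, hav⟩ := hP.2.2.exists_hd_eq hP.1
  have hfa := (hPD a ha).trans hD
  rcases hs (.inl v) (.inr v) (by rwa [hD]) with h | h
  · by_cases hal : a = .inr (.inl v, .inr v)
    · rwa [← hal]
    · exact absurd (hfa.symm.trans (h a hal)) hα.ne'
  · rcases a with l | ⟨p, q⟩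
    · obtain rfl := hd_inl_eq_inr hav
      have h1 := hcong.1 (.inr v) true
      have h2 := le_totalFlow hf.nonneg (.inl v) (.inr v) (.inl (.inr v, true))
      simp only [cap2] at h1
      linarith
    · exact absurd (hfa.symm.trans (h p q)) hα.ne'

/-- The base flow induced by a flow on the constructed network; commodities without demand
are dropped. -/
noncomputable def restrictFlow {V E : Type*} (D : V → V → ℝ)
    (f : V ⊕ V → V ⊕ V → SLink (V ⊕ V) (E ⊕ V) → ℝ) (i j : V) : SLink V E → ℝ :=
  if 0 < D i j then restrict (f (.inl i) (.inl j)) else fun _ => 0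

lemma isFlow_restrictFlow {V E : Type*} [Fintype V] [DecidableEq V] [Fintype E]
    {src tgt : E → V} {D : V → V → ℝ} (hD : ∀ i j, 0 ≤ D i j)
    (hDdiag : ∀ i, D i i = 0) {α : ℝ} {M : Finset (Sym2 (V ⊕ V))}
    {f : V ⊕ V → V ⊕ V → SLink (V ⊕ V) (E ⊕ V) → ℝ}
    (hf : IsFlow (src2 src) (tgt2 tgt) (D2 D α) M f)
    (hstat : ∀ i j, 0 < D i j → ∀ p, f (.inl i) (.inl j) (.inr p) = 0) :
    IsFlow src tgt D ∅ (restrictFlow D f) where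
  nonneg i j a := by
    unfold restrictFlow
    split_ifs
    · rcases a with ⟨e, b⟩ | p
      · exact hf.nonneg _ _ _
      · exact le_rfl
    · exact le_rfl
  supp i j p q _ := by
    unfold restrictFlow
    split_ifs <;> rfl
  diag i a := by simp [restrictFlow, hDdiag]
  conserve i j v hi hj := by
    unfold restrictFlow
    split_ifs with h
    · rw [netOut_restrict _ _ _ (hstat i j h),
        hf.conserve _ _ _ (by simpa using hi) (by simpa using hj),
        hf.conserve _ _ _ (by simp) (by simp), add_zero]
    · exact netOut_zero _ _ _
  demand i j hij := by
    unfold restrictFlow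
    split_ifs with h
    · rw [netOut_restrict _ _ _ (hstat i j h), hf.demand _ _ (by simpa using hij),
        hf.conserve _ _ _ (by simp) (by simp), add_zero, D2]
    · rw [netOut_zero, le_antisymm (not_lt.1 h) (hD i j)]

lemma unsplittable_restrictFlow {V E : Type*} [DecidableEq V]
    {src tgt : E → V} {D : V → V → ℝ}
    (hDdiag : ∀ i, D i i = 0) {α : ℝ}
    {f : V ⊕ V → V ⊕ V → SLink (V ⊕ V) (E ⊕ V) → ℝ}
    (hu : Unsplittable (src2 src) (tgt2 tgt) (D2 D α) f)
    (hstat : ∀ i j, 0 < D i j → ∀ p, f (.inl i) (.inl j) (.inr p) = 0) :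
    Unsplittable src tgt D (restrictFlow D f) := by
  intro i j hij
  obtain ⟨P, hP, hPD, hP0⟩ := hu (.inl i) (.inl j) hij
  have hne : i ≠ j := by
    rintro rfl
    exact hij.ne' (hDdiag i)
  refine ⟨P.filterMap baseLink, isDiPath_filterMap_baseLink hne hP fun p hp =>
    hij.ne' ((hPD _ hp).symm.trans (hstat i j hij p)), ?_, ?_⟩
  · intro a ha
    obtain ⟨a', ha', h⟩ := List.mem_filterMap.1 ha
    obtain ⟨e, b, rfl, rfl⟩ := baseLink_eq_some h
    simpa [restrictFlow, hij, restrict, D2] using hPD _ ha'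
  · rintro (⟨e, b⟩ | p) ha
    · simpa [restrictFlow, hij, restrict] using
        hP0 (.inl (.inl e, b)) fun h => ha (List.mem_filterMap.2 ⟨_, h, rfl⟩)
    · simp [restrictFlow, hij, restrict]

lemma totalFlow_restrictFlow_le {V E : Type*} [Fintype V]
    (D : V → V → ℝ)
    {f : V ⊕ V → V ⊕ V → SLink (V ⊕ V) (E ⊕ V) → ℝ} (hf : ∀ i j a, 0 ≤ f i j a)
    (e : E) (b : Bool) :
    totalFlow (restrictFlow D f) (.inl (e, b)) ≤ totalFlow f (.inl (.inl e, b)) := by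
  have hle : ∀ i j, restrictFlow D f i j (.inl (e, b)) ≤
      f (.inl i) (.inl j) (.inl (.inl e, b)) := by
    intro i j
    unfold restrictFlow
    split_ifs
    · exact le_rfl
    · exact hf _ _ _
  simp only [totalFlow, Fintype.sum_sum_type]
  refine le_add_of_le_of_nonneg (Finset.sum_le_sum fun i _ =>
    le_add_of_le_of_nonneg (Finset.sum_le_sum fun j _ => hle i j) ?_) ?_
  · exact Finset.sum_nonneg fun j _ => hf _ _ _
  · exact Finset.sum_nonneg fun i _ => add_nonneg (Finset.sum_nonneg fun j _ => hf _ _ _)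
      (Finset.sum_nonneg fun j _ => hf _ _ _)

end Red

/-- let `optI` be the minimum congestion over unsplittable flows
serving `D` in the original network (minimum capacity `1`), and let
`α > max optI 1`. Then the optimal congestion of the constructed MCRN instance under
unsplittable segregated routing equals `max optI 1`. -/
theorem reduction_optimum
    {V E : Type*} [Fintype V] [DecidableEq V] [Fintype E] [DecidableEq E]
    (src tgt : E → V) (c : E → Bool → ℝ)
    (hc1 : ∀ e b, 1 ≤ c e b) (hcattain : ∃ e b, c e b = 1)
    (D : V → V → ℝ) (hD : ∀ i j, 0 ≤ D i j) (hDdiag : ∀ i, D i i = 0)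
    (optI : ℝ)
    (hopt : IsLeast {lam : ℝ | ∃ g : V → V → SLink V E → ℝ,
      IsFlow src tgt D (∅ : Finset (Sym2 V)) g ∧
      Unsplittable src tgt D g ∧
      CongLE (capBase c) (∅ : Finset (Sym2 V)) g lam} optI)
    (α : ℝ) (hα : max optI 1 < α) :
    IsLeast {lam : ℝ | ∃ (M : Finset (Sym2 (V ⊕ V)))
        (f : (V ⊕ V) → (V ⊕ V) → SLink (V ⊕ V) (E ⊕ V) → ℝ),
      IsMatching M ∧
      IsFlow (src2 src) (tgt2 tgt) (D2 D α) M f ∧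
      Unsplittable (src2 src) (tgt2 tgt) (D2 D α) f ∧
      Segregated (D2 D α) f ∧
      CongLE (cap2 c α) M f lam} (max optI 1) := by
  have h1 : 1 ≤ max optI 1 := le_max_right _ _
  have hα0 : 0 < α := by linarith
  constructor
  · obtain ⟨g, hg, hu, hcong⟩ := hopt.1
    exact ⟨pairMatching V, extendFlow α g, isMatching_pairMatching,
      isFlow_extendFlow hg hα0.le, unsplittable_extendFlow hg hu α,
      segregated_extendFlow D g α,
      congLE_extendFlow (fun e b => zero_le_one.trans (hc1 e b)) hcong (le_max_left _ _) h1
        hα0.le⟩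
  · rintro lam ⟨M, f, hM, hf, hu, hs, hcong⟩
    by_contra! hlam
    have hpair := flow_pair_eq hf hu hs hcong hα0 (hlam.trans hα)
    have hmem : ∀ v : V, s(.inl v, .inr v) ∈ M := by
      intro v
      by_contra h
      exact hα0.ne' ((hpair v).symm.trans (hf.supp _ _ _ _ h))
    have hlam1 : 1 ≤ lam := by
      obtain ⟨e, -, -⟩ := hcattain
      have h2 := hcong.2 _ _ (hmem (src e))
      have h3 := le_totalFlow hf.nonneg (.inl (src e)) (.inr (src e))
        (.inr (.inl (src e), .inr (src e)))
      rw [hpair] at h3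
      simp only [cap2, if_true] at h2
      exact le_of_mul_le_mul_right (by linarith) hα0
    have hstat : ∀ i j, 0 < D i j → ∀ p, f (.inl i) (.inl j) (.inr p) = 0 := by
      rintro i j hij ⟨p, q⟩
      rcases hs (.inl i) (.inl j) hij with h | h
      · by_cases hpq : (p, q) = (Sum.inl i, Sum.inl j)
        · obtain ⟨rfl, rfl⟩ := Prod.mk.inj hpq
          exact hf.supp _ _ _ _ (hM.inl_inl_notMem hmem i j)
        · exact h _ (by simpa using hpq)
      · exact h p q
    have hopt_le : optI ≤ lam := hopt.2 ⟨restrictFlow D f, isFlow_restrictFlow hD hDdiag hf hstat,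
      unsplittable_restrictFlow hDdiag hu hstat,
      fun e b => (totalFlow_restrictFlow_le D hf.nonneg e b).trans (hcong.1 (.inl e) b),
      by simp⟩
    exact absurd (max_le hopt_le hlam1) (not_le.2 hlam)

end MCRN
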